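/- Let 0 < δ₁ < δ₂ with δ₂ − δ₁ < 1 and let H : [δ₁,δ₂] → (0,1). For s ∈ [δ₁,δ₂] let g_s(x) = (s−x)₊^{H(s)−1/2} log((s−x)₊) − (−x)₊^{H(s)−1/2} log((−x)₊). Then for every integer n ≥ 2, all points δ₁ ≤ s¹ < s² < … < sⁿ ≤ δ₂ and all reals a₁,…,a_{n−1}: ∫_ℝ ( g_{sⁿ}(x) − Σ_{l=1}^{n−1} a_l g_{s^l}(x) )² dx ≥ (1/2) (sⁿ − s^{n−1})^{2H(sⁿ)} log²(sⁿ − s^{n−1}). (By the Wiener isometry this is the one-sided strong local nondeterminism Var(Y(sⁿ) | Y(s¹),…,Y(s^{n−1})) ≥ (1/2)(sⁿ−s^{n−1})^{2H(sⁿ)} log²(sⁿ−s^{n−1}) for the Gaussian process Y with these integrands.) -/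

import Mathlib

open MeasureTheory Set

noncomputable section

/-- `y₊^{h−1/2} log(y₊)`: equals `y^{h−1/2} log y` if `y > 0` and `0` otherwise. -/
def logKernel (h y : ℝ) : ℝ := if 0 < y then y ^ (h - 1/2) * Real.log y else 0

/-- The integrand `g_s` of the paper, depending on a functional parameter `H`. -/
def gKer (H : ℝ → ℝ) (s x : ℝ) : ℝ :=
  logKernel (H s) (s - x) - logKernel (H s) (-x)

theorem logKernel_measurable (h : ℝ) : Measurable (logKernel h) := by
  unfold logKernel
  refine Measurable.ite measurableSet_Ioi ?_ measurable_const
  exact (measurable_id.pow_const _).mul Real.measurable_log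

theorem logKernel_memLp_one (h : ℝ) (h0 : 0 < h) :
    MemLp ((Iic (1:ℝ)).indicator (logKernel h)) 2 volume := by
  rw [memLp_two_iff_integrable_sq
    ((logKernel_measurable h).indicator measurableSet_Iic).aestronglyMeasurable]
  have hint : IntegrableOn (fun y : ℝ => (2/h)^2 * y ^ (h - 1)) (Ioc 0 1) := by
    have := (intervalIntegral.intervalIntegrable_rpow' (a := 0) (b := 1) (r := h - 1)
      (by linarith))
    rw [intervalIntegrable_iff_integrableOn_Ioc_of_le zero_le_one] at this
    exact this.const_mul _
  have hint2 := (integrable_indicator_iff measurableSet_Ioc).2 hint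
  refine hint2.mono'
    (((logKernel_measurable h).indicator measurableSet_Iic).pow_const 2).aestronglyMeasurable ?_
  refine Filter.Eventually.of_forall fun y => ?_
  by_cases hy : y ∈ Ioc (0:ℝ) 1
  · rw [indicator_of_mem hy, indicator_of_mem (show y ∈ Iic (1:ℝ) from hy.2)]
    have hy0 := hy.1
    simp only [logKernel, hy.1, if_true]
    have key := (Real.abs_log_mul_self_rpow_lt y (h/2) hy.1 hy.2 (by positivity)).le
    have e : y ^ (h - 1/2) * Real.log y = (Real.log y * y ^ (h/2)) * y ^ (h/2 - 1/2) := by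
      rw [mul_assoc, ← Real.rpow_add hy0]; ring_nf
    have e2 : y ^ (h - 1) = (y ^ (h/2 - 1/2)) ^ 2 := by
      rw [← Real.rpow_natCast, ← Real.rpow_mul hy0.le]; congr 1; push_cast; ring
    rw [e, e2, mul_pow, Real.norm_eq_abs, abs_of_nonneg (by positivity)]
    gcongr ?_ * _
    rw [← sq_abs]
    have : 1 / (h/2) = 2/h := by field_simp
    rw [this] at key
    gcongr
  · rw [indicator_of_notMem hy]
    have : (Iic (1:ℝ)).indicator (logKernel h) y = 0 := by
      by_cases h1 : y ≤ 1
      · rw [indicator_of_mem (show y ∈ Iic (1:ℝ) from h1)]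
        have : ¬ 0 < y := fun h => hy ⟨h, h1⟩
        simp [logKernel, this]
      · exact indicator_of_notMem (by simpa using h1) _
    simp [this]

theorem logKernel_memLp (h : ℝ) (h0 : 0 < h) (c : ℝ) (hc : 1 ≤ c) :
    MemLp ((Iic c).indicator (logKernel h)) 2 volume := by
  have h2 : MemLp ((Icc (1:ℝ) c).indicator (logKernel h)) 2 volume := by
    rw [memLp_two_iff_integrable_sq
      ((logKernel_measurable h).indicator measurableSet_Icc).aestronglyMeasurable]
    have hcont : ContinuousOn (fun y : ℝ => (y ^ (h - 1/2) * Real.log y)^2) (Icc 1 c) := by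
      refine ContinuousOn.pow (ContinuousOn.mul ?_ ?_) 2
      · exact continuousOn_id.rpow_const fun x hx => Or.inl (by simp at hx ⊢; linarith)
      · exact Real.continuousOn_log.mono fun x hx => by simp at hx ⊢; linarith
    have hi := (integrable_indicator_iff measurableSet_Icc).2 (hcont.integrableOn_Icc (μ := volume))
    refine hi.congr (Filter.Eventually.of_forall fun y => ?_)
    by_cases hy : y ∈ Icc (1:ℝ) c
    · have : 0 < y := by linarith [hy.1]
      simp only [indicator_of_mem hy, logKernel, this, if_true]
    · simp [indicator_of_notMem hy]
  have h3 : MemLp ((Ioc (1:ℝ) c).indicator (logKernel h)) 2 volume := by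
    have := h2.indicator (measurableSet_Ioc (a := (1:ℝ)) (b := c))
    rwa [indicator_indicator, inter_eq_left.2 Ioc_subset_Icc_self] at this
  have := (logKernel_memLp_one h h0).add h3
  refine this.ae_eq (Filter.Eventually.of_forall fun y => ?_)
  by_cases h1 : y ≤ 1
  · have : y ≤ c := h1.trans hc
    have h1' : ¬ 1 < y := not_lt.2 h1
    simp [indicator, h1, this, h1']
  · by_cases h5 : y ≤ c <;> simp [indicator, h1, h5, not_le.1 h1]

theorem incr_bound (h : ℝ) (h1 : h < 1) (s : ℝ) (hs : 0 < s) :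
    ∃ K, ∀ t, 1 ≤ t → |logKernel h (t + s) - logKernel h t| ≤ K * t ^ (h/2 - 1) := by
  set ε := (1 - h)/2 with hε
  have hε0 : 0 < ε := by rw [hε]; linarith
  refine ⟨(|h - 1/2| * (1/ε) + 1) * s, fun t ht => ?_⟩
  set C := |h - 1/2| * (1/ε) + 1 with hC
  have hC0 : 0 ≤ C := by positivity
  have e1 : ∀ y, 1 ≤ y → logKernel h y = y ^ (h - 1/2) * Real.log y := fun y hy => by
    have : 0 < y := by linarith
    simp [logKernel, this]
  rw [e1 _ ht, e1 _ (by linarith)]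
  have := Convex.norm_image_sub_le_of_norm_hasDerivWithin_le
    (f := fun y : ℝ => y ^ (h - 1/2) * Real.log y)
    (f' := fun y : ℝ => (h - 1/2) * y ^ (h - 1/2 - 1) * Real.log y + y ^ (h - 1/2) * y⁻¹)
    (s := Icc t (t+s)) (C := C * t ^ (h/2 - 1)) (x := t) (y := t + s) ?_ ?_
    (convex_Icc _ _) ⟨le_rfl, by linarith⟩ ⟨by linarith, le_rfl⟩
  · simp only [Real.norm_eq_abs, add_sub_cancel_left, abs_of_pos hs] at this
    linarith
  · intro y hy
    have hy0 : 0 < y := by linarith [hy.1]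
    exact ((Real.hasDerivAt_rpow_const (Or.inl hy0.ne')).mul
      (Real.hasDerivAt_log hy0.ne')).hasDerivWithinAt
  · intro y hy
    have hy1 : 1 ≤ y := by linarith [hy.1]
    have hy0 : 0 < y := by linarith
    have e : y ^ (h - 1/2) * y⁻¹ = y ^ (h - 1/2 - 1) := by
      rw [Real.rpow_sub_one hy0.ne']; rfl
    have hl := Real.log_le_rpow_div hy0.le hε0
    have hl0 := Real.log_nonneg hy1
    have hp : 1 ≤ y ^ ε := Real.one_le_rpow hy1 hε0.le
    rw [e, Real.norm_eq_abs]
    calc |(h - 1/2) * y ^ (h - 1/2 - 1) * Real.log y + y ^ (h - 1/2 - 1)|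
        = |(h - 1/2) * Real.log y + 1| * y ^ (h - 1/2 - 1) := by
          rw [← abs_of_pos (Real.rpow_pos_of_pos hy0 (h - 1/2 - 1)), ← abs_mul,
            abs_of_pos (Real.rpow_pos_of_pos hy0 (h - 1/2 - 1))]; ring_nf
      _ ≤ (C * y ^ ε) * y ^ (h - 1/2 - 1) := by
          gcongr
          calc _ ≤ |(h - 1/2) * Real.log y| + |(1:ℝ)| := abs_add_le _ _
            _ = |h - 1/2| * Real.log y + 1 := by rw [abs_mul, abs_of_nonneg hl0, abs_one]
            _ ≤ |h - 1/2| * (y ^ ε / ε) + y ^ ε := by gcongr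
            _ = _ := by rw [hC]; ring
      _ = C * y ^ (h/2 - 1) := by
          rw [mul_assoc, ← Real.rpow_add hy0, hε]; ring_nf
      _ ≤ C * t ^ (h/2 - 1) := by
          refine mul_le_mul_of_nonneg_left ?_ hC0
          exact Real.rpow_le_rpow_of_nonpos (lt_of_lt_of_le one_pos ht) hy.1 (by linarith)

theorem incr_memLp (h : ℝ) (h0 : 0 < h) (h1 : h < 1) (s : ℝ) (hs : 0 < s) :
    MemLp (fun t => logKernel h (t + s) - logKernel h t) 2 volume := by
  have hm : Measurable (fun t => logKernel h (t + s) - logKernel h t) :=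
    ((logKernel_measurable h).comp (measurable_id.add_const s)).sub (logKernel_measurable h)
  obtain ⟨K, hK⟩ := incr_bound h h1 s hs
  have A : MemLp ((Ioi (1:ℝ)).indicator (fun t => logKernel h (t + s) - logKernel h t)) 2 volume := by
    have hmi := hm.indicator (measurableSet_Ioi (a := (1:ℝ)))
    rw [memLp_two_iff_integrable_sq hmi.aestronglyMeasurable]
    have hi := (integrable_indicator_iff measurableSet_Ioi).2
      ((integrableOn_Ioi_rpow_of_lt (a := h - 2) (c := 1) (by linarith) one_pos).const_mul (K^2))
    refine hi.mono' (hmi.pow_const 2).aestronglyMeasurable (Filter.Eventually.of_forall fun t => ?_)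
    by_cases ht : t ∈ Ioi (1:ℝ)
    · rw [indicator_of_mem ht, indicator_of_mem ht]
      have ht' : 1 < t := ht
      have ht0 : 0 < t := by linarith
      have e2 : t ^ (h - 2) = (t ^ (h/2 - 1)) ^ 2 := by
        rw [← Real.rpow_natCast, ← Real.rpow_mul ht0.le]; congr 1; push_cast; ring
      rw [e2, ← mul_pow, Real.norm_eq_abs, abs_of_nonneg (sq_nonneg _), ← sq_abs]
      have := hK t ht'.le
      gcongr
    · simp [indicator_of_notMem ht]
  have B1 := (logKernel_memLp h h0 (1 + s) (by linarith)).comp_measurePreserving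
    (measurePreserving_add_right volume s)
  have B := (B1.sub (logKernel_memLp h h0 1 le_rfl)).add A
  refine B.ae_eq (Filter.Eventually.of_forall fun t => ?_)
  by_cases ht : t ≤ 1
  · have : ¬ 1 < t := not_lt.2 ht
    simp [indicator, ht, this]
  · simp [indicator, ht, not_le.1 ht]

theorem gKer_memLp (H : ℝ → ℝ) (s : ℝ) (hs : 0 < s) (hH : H s ∈ Ioo (0:ℝ) 1) :
    MemLp (gKer H s) 2 volume := by
  have := (incr_memLp (H s) hH.1 hH.2 s hs).comp_measurePreserving
    (Measure.measurePreserving_neg volume)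
  refine this.ae_eq (Filter.Eventually.of_forall fun x => ?_)
  simp only [gKer, Function.comp]
  rw [neg_add_eq_sub]

theorem lower_int (p q h : ℝ) (hpq : p < q) (hr : q - p < 1) (h0 : 0 < h) (h1 : h < 1) :
    2⁻¹ * (q - p) ^ (2 * h) * Real.log (q - p) ^ 2 ≤
      ∫ x in Ioo p q, Real.log (q - p) ^ 2 * (q - x) ^ (2 * h - 1) := by
  rw [← integral_Ioc_eq_integral_Ioo, ← intervalIntegral.integral_of_le hpq.le,
    intervalIntegral.integral_const_mul,
    intervalIntegral.integral_comp_sub_left (fun x => x ^ (2 * h - 1)) q,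
    integral_rpow (Or.inl (by linarith))]
  have : 2 * h - 1 + 1 = 2 * h := by ring
  rw [this, sub_self, Real.zero_rpow (by linarith), sub_zero, mul_comm]
  have hp : 0 < (q - p) ^ (2 * h) := Real.rpow_pos_of_pos (by linarith) _
  gcongr
  rw [le_div_iff₀ (by linarith)]
  nlinarith

/-- One-sided strong local nondeterminism: for points
`δ₁ ≤ s¹ < … < sⁿ ≤ δ₂` (here `n = m+2 ≥ 2`) and any reals `a₁,…,a_{n−1}`,
`∫ (g_{sⁿ} − Σ a_l g_{s^l})² ≥ (1/2)(sⁿ−s^{n−1})^{2H(sⁿ)} log²(sⁿ−s^{n−1})`. -/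
theorem one_sided_strong_local_nondeterminism
    (δ₁ δ₂ : ℝ) (h₁ : 0 < δ₁) (h₂ : δ₁ < δ₂) (h₃ : δ₂ - δ₁ < 1)
    (H : ℝ → ℝ) (hHrange : ∀ s ∈ Set.Icc δ₁ δ₂, H s ∈ Set.Ioo (0:ℝ) 1)
    (m : ℕ) (s : Fin (m + 2) → ℝ) (hmono : StrictMono s)
    (hrange : ∀ i, s i ∈ Set.Icc δ₁ δ₂)
    (a : Fin (m + 1) → ℝ) :
    2⁻¹ * (s (Fin.last (m + 1)) - s ⟨m, by omega⟩) ^ (2 * H (s (Fin.last (m + 1))))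
        * Real.log (s (Fin.last (m + 1)) - s ⟨m, by omega⟩) ^ 2
      ≤ ∫ x : ℝ, (gKer H (s (Fin.last (m + 1))) x
          - ∑ l : Fin (m + 1), a l * gKer H (s l.castSucc) x) ^ 2 := by
  set p := s ⟨m, by omega⟩ with hp
  set q := s (Fin.last (m + 1)) with hq
  have hpq : p < q := hmono (by simp [Fin.lt_def])
  have hp1 := hrange ⟨m, by omega⟩
  have hq1 := hrange (Fin.last (m + 1))
  rw [← hp] at hp1
  rw [← hq] at hq1
  have hr : q - p < 1 := by linarith [hp1.1, hq1.2]
  have hp0 : 0 < p := by linarith [hp1.1]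
  have hHq := hHrange q hq1
  set G : ℝ → ℝ := fun x => gKer H q x - ∑ l : Fin (m + 1), a l * gKer H (s l.castSucc) x with hG
  have hGm : MemLp G 2 volume := by
    refine (gKer_memLp H q (by linarith) hHq).sub (memLp_finsetSum _ fun l _ => ?_)
    have hl := hrange l.castSucc
    exact (gKer_memLp H _ (by linarith [hl.1]) (hHrange _ hl)).const_mul (a l)
  have hGi : Integrable (fun x => G x ^ 2) := hGm.integrable_sq
  refine (lower_int p q (H q) hpq hr hHq.1 hHq.2).trans ?_
  refine le_trans ?_ (setIntegral_le_integral (s := Ioo p q) hGi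
    (Filter.Eventually.of_forall fun x => sq_nonneg _))
  refine setIntegral_mono_on ?_ hGi.integrableOn measurableSet_Ioo fun x hx => ?_
  · have hi := (intervalIntegral.intervalIntegrable_rpow' (a := q - p) (b := q - q)
      (r := 2 * H q - 1) (by linarith [hHq.1])).comp_sub_left q
    simp only [sub_sub_cancel] at hi
    rw [intervalIntegrable_iff_integrableOn_Ioo_of_le hpq.le] at hi
    exact hi.const_mul _
  · have hxq : 0 < q - x := by linarith [hx.2]
    have hx0 : ¬ 0 < -x := by linarith [hx.1]
    have hz : ∀ l : Fin (m + 1), gKer H (s l.castSucc) x = 0 := fun l => by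
      have : s l.castSucc ≤ p := hmono.monotone (by
        rw [Fin.le_def]; simp; omega)
      have h' : ¬ 0 < s l.castSucc - x := by linarith [hx.1]
      simp only [gKer, logKernel, if_neg h', if_neg hx0, sub_zero]
    have hGx : G x = (q - x) ^ (H q - 1/2) * Real.log (q - x) := by
      simp only [hG, hz, mul_zero, Finset.sum_const_zero, sub_zero]
      simp only [gKer, logKernel, if_neg hx0, if_pos hxq, sub_zero]
    have e2 : (q - x) ^ (2 * H q - 1) = ((q - x) ^ (H q - 1/2)) ^ 2 := by
      rw [← Real.rpow_natCast, ← Real.rpow_mul hxq.le]; congr 1; push_cast; ring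
    change _ ≤ G x ^ 2
    rw [hGx, e2, mul_pow, mul_comm]
    gcongr ?_ * ?_
    have l1 : Real.log (q - x) ≤ Real.log (q - p) := Real.log_le_log hxq (by linarith [hx.1])
    have l2 : Real.log (q - p) < 0 := Real.log_neg (by linarith) hr
    nlinarith

end
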